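/- For every integer n ≥ 2, the group T_n is finitely generated; indeed it is generated by a set of n+1 elements. -/

import Mathlib

noncomputable section

namespace ThompsonPaper

/-- The circle `ℝ/ℤ`. -/
abbrev Circle : Type := AddCircle (1 : ℝ)

/-- Homeomorphisms of a topological space form a group under composition,
with `(f * g) x = f (g x)`. -/
instance homeoGroup {α : Type*} [TopologicalSpace α] : Group (α ≃ₜ α) where
  mul f g := g.trans f
  one := Homeomorph.refl α
  inv := Homeomorph.symm
  mul_assoc _ _ _ := Homeomorph.ext fun _ => rfl
  one_mul _ := Homeomorph.ext fun _ => rfl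
  mul_one _ := Homeomorph.ext fun _ => rfl
  inv_mul_cancel f := Homeomorph.ext fun x => f.symm_apply_apply x

/-- `x` is an `n`-adic rational: `x = a / n ^ k` with `a` an integer, `k` a natural number. -/
def IsNAdic (n : ℕ) (x : ℝ) : Prop := ∃ a : ℤ, ∃ k : ℕ, x = (a : ℝ) / (n : ℝ) ^ k

/-- The set of `n`-adic points of the circle. -/
def nAdicPoints (n : ℕ) : Set Circle := { p | ∃ x : ℝ, IsNAdic n x ∧ p = (x : Circle) }

/-- `F : ℝ → ℝ` is a lift of the circle map `f`. -/
def IsLift (f : Circle ≃ₜ Circle) (F : ℝ → ℝ) : Prop :=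
  ∀ x : ℝ, f (x : Circle) = ((F x : ℝ) : Circle)

/-- `F : ℝ → ℝ` commutes with translation by `1` and is piecewise affine with finitely
many breakpoints (modulo `1`), all breakpoints at `n`-adic rationals, and with the slope
of every affine piece an integer power of `n`. -/
def PiecewiseNAffine (n : ℕ) (F : ℝ → ℝ) : Prop :=
  (∀ x : ℝ, F (x + 1) = F x + 1) ∧
  ∃ m : ℕ, ∃ t : ℕ → ℝ, ∃ slope : ℕ → ℤ, ∃ c : ℕ → ℝ,
    0 < m ∧ t 0 = 0 ∧ t m = 1 ∧
    (∀ i, i < m → t i < t (i + 1)) ∧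
    (∀ i, i ≤ m → IsNAdic n (t i)) ∧
    (∀ i, i < m → ∀ x ∈ Set.Icc (t i) (t (i + 1)),
      F x = (n : ℝ) ^ (slope i) * x + c i)

/-- Membership in Thompson's group `T_n`: an orientation-preserving homeomorphism of the
circle `ℝ/ℤ` mapping the set of `n`-adic points onto itself, which is piecewise affine
with finitely many breakpoints, all breakpoints at `n`-adic points, and all slopes integer
powers of `n`.  (Orientation preservation and the piecewise affine structure are expressed
through a strictly increasing lift.) -/
def InT (n : ℕ) (f : Circle ≃ₜ Circle) : Prop :=
  f '' nAdicPoints n = nAdicPoints n ∧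
  ∃ F : ℝ → ℝ, StrictMono F ∧ IsLift f F ∧ PiecewiseNAffine n F

/-- Thompson's group `T_n`, as a set of circle homeomorphisms. -/
def TnSet (n : ℕ) : Set (Circle ≃ₜ Circle) := { f | InT n f }

/-- Thompson's group `T_n`, as a subgroup of the homeomorphism group of the circle.
(The set `TnSet n` is closed under the group operations, so this subgroup has exactly
`TnSet n` as its underlying set.) -/
def Tn (n : ℕ) : Subgroup (Circle ≃ₜ Circle) := Subgroup.closure (TnSet n)




section basics
variable {n : ℕ}

lemma hmul_apply (f g : Circle ≃ₜ Circle) (x : Circle) : (f * g) x = f (g x) := rfl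
lemma hone_apply (x : Circle) : (1 : Circle ≃ₜ Circle) x = x := rfl
lemma hinv_apply_self (f : Circle ≃ₜ Circle) (x : Circle) : f⁻¹ (f x) = x := f.symm_apply_apply x
lemma happly_inv_self (f : Circle ≃ₜ Circle) (x : Circle) : f (f⁻¹ x) = x := f.apply_symm_apply x

lemma npos (hn : 2 ≤ n) : (0 : ℝ) < n := by
  have : 0 < n := by omega
  exact_mod_cast this

lemma nadic_int (z : ℤ) : IsNAdic n (z : ℝ) := ⟨z, 0, by simp⟩

lemma nadic_neg {x : ℝ} (hx : IsNAdic n x) : IsNAdic n (-x) := by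
  obtain ⟨a, k, rfl⟩ := hx
  exact ⟨-a, k, by push_cast; ring⟩

lemma nadic_add (hn : 2 ≤ n) {x y : ℝ} (hx : IsNAdic n x) (hy : IsNAdic n y) :
    IsNAdic n (x + y) := by
  obtain ⟨a, k, rfl⟩ := hx
  obtain ⟨b, l, rfl⟩ := hy
  have := npos hn
  refine ⟨a * n ^ l + b * n ^ k, k + l, ?_⟩
  push_cast
  field_simp
  ring

lemma nadic_sub (hn : 2 ≤ n) {x y : ℝ} (hx : IsNAdic n x) (hy : IsNAdic n y) :
    IsNAdic n (x - y) := by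
  rw [sub_eq_add_neg]; exact nadic_add hn hx (nadic_neg hy)

lemma nadic_mul (hn : 2 ≤ n) {x y : ℝ} (hx : IsNAdic n x) (hy : IsNAdic n y) :
    IsNAdic n (x * y) := by
  obtain ⟨a, k, rfl⟩ := hx
  obtain ⟨b, l, rfl⟩ := hy
  have := npos hn
  refine ⟨a * b, k + l, ?_⟩
  push_cast
  field_simp
  ring

lemma nadic_zpow (s : ℤ) : IsNAdic n ((n : ℝ) ^ s) := by
  rcases Int.eq_nat_or_neg s with ⟨k, rfl | rfl⟩
  · exact ⟨n ^ k, 0, by simp⟩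
  · exact ⟨1, k, by simp⟩

lemma nadic_div (a : ℤ) (k : ℕ) : IsNAdic n ((a : ℝ) / (n : ℝ) ^ k) := ⟨a, k, rfl⟩

lemma coe_eq_iff (x y : ℝ) : ((x : Circle) = (y : Circle)) ↔ ∃ z : ℤ, x = y + z := by
  rw [← sub_eq_zero, ← AddCircle.coe_sub, AddCircle.coe_eq_zero_iff]
  constructor
  · rintro ⟨z, hz⟩
    refine ⟨z, ?_⟩
    simp at hz
    linarith
  · rintro ⟨z, hz⟩
    refine ⟨z, ?_⟩
    simp
    linarith

lemma coe_mem_nadic (hn : 2 ≤ n) (x : ℝ) : (x : Circle) ∈ nAdicPoints n ↔ IsNAdic n x := by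
  constructor
  · rintro ⟨y, hy, h⟩
    obtain ⟨z, rfl⟩ := (coe_eq_iff x y).1 h
    exact nadic_add hn hy (nadic_int z)
  · intro h; exact ⟨x, h, rfl⟩

lemma coe_surj (p : Circle) : ∃ x : ℝ, 0 ≤ x ∧ x < 1 ∧ (x : Circle) = p := by
  obtain ⟨y, rfl⟩ := QuotientAddGroup.mk_surjective p
  refine ⟨Int.fract y, Int.fract_nonneg y, Int.fract_lt_one y, ?_⟩
  exact (coe_eq_iff _ _).2 ⟨-⌊y⌋, by rw [← Int.self_sub_floor]; push_cast; ring⟩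

/-- circle map from a lift -/
def circMap (F : ℝ → ℝ) (h : ∀ x, F (x + 1) = F x + 1) : Circle → Circle :=
  Function.Periodic.lift (f := fun x => ((F x : ℝ) : Circle)) (c := (1 : ℝ)) (by
    intro x
    exact (coe_eq_iff _ _).2 ⟨1, by rw [h]; simp⟩)

lemma circMap_coe (F : ℝ → ℝ) (h : ∀ x, F (x + 1) = F x + 1) (x : ℝ) :
    circMap F h (x : Circle) = ((F x : ℝ) : Circle) := rfl

lemma circMap_cont (F : ℝ → ℝ) (h : ∀ x, F (x + 1) = F x + 1) (hF : Continuous F) :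
    Continuous (circMap F h) := by
  have := QuotientAddGroup.isQuotientMap_mk (AddSubgroup.zmultiples (1 : ℝ))
  rw [this.continuous_iff]
  exact (AddCircle.continuous_mk' (1 : ℝ)).comp hF

lemma symm_add_one (F : ℝ ≃o ℝ) (h : ∀ x, F (x + 1) = F x + 1) (x : ℝ) :
    F.symm (x + 1) = F.symm x + 1 := by
  rw [OrderIso.symm_apply_eq, h]; simp

/-- circle homeomorphism from an order isomorphism of the line -/
def circHomeo (F : ℝ ≃o ℝ) (h : ∀ x, F (x + 1) = F x + 1) : Circle ≃ₜ Circle where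
  toFun := circMap F h
  invFun := circMap F.symm (symm_add_one F h)
  left_inv p := by
    obtain ⟨x, -, -, rfl⟩ := coe_surj p
    rw [circMap_coe, circMap_coe]; simp
  right_inv p := by
    obtain ⟨x, -, -, rfl⟩ := coe_surj p
    rw [circMap_coe, circMap_coe]; simp
  continuous_toFun := circMap_cont _ _ F.continuous
  continuous_invFun := circMap_cont _ _ F.symm.continuous

lemma circHomeo_coe (F : ℝ ≃o ℝ) (h : ∀ x, F (x + 1) = F x + 1) (x : ℝ) :
    circHomeo F h (x : Circle) = ((F x : ℝ) : Circle) := rfl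

lemma circHomeo_inv (F : ℝ ≃o ℝ) (h : ∀ x, F (x + 1) = F x + 1) :
    (circHomeo F h)⁻¹ = circHomeo F.symm (symm_add_one F h) := rfl

/-- `F` sends the pieces of `t` affinely onto the pieces of `u`. -/
def Pieces (n m : ℕ) (t u : ℕ → ℝ) : Prop :=
  0 < m ∧ t 0 = 0 ∧ t m = 1 ∧ u 0 = 0 ∧ u m = 1 ∧
  (∀ i, i < m → t i < t (i + 1)) ∧ (∀ i, i < m → u i < u (i + 1)) ∧
  (∀ i, i ≤ m → IsNAdic n (t i)) ∧ (∀ i, i ≤ m → IsNAdic n (u i)) ∧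
  (∀ i, i < m → ∃ s : ℤ, u (i + 1) - u i = (n : ℝ) ^ s * (t (i + 1) - t i))

lemma Pieces.symm (hn : 2 ≤ n) {m : ℕ} {t u : ℕ → ℝ} (h : Pieces n m t u) : Pieces n m u t := by
  obtain ⟨h1, h2, h3, h4, h5, h6, h7, h8, h9, h10⟩ := h
  refine ⟨h1, h4, h5, h2, h3, h7, h6, h9, h8, fun i hi => ?_⟩
  obtain ⟨s, hs⟩ := h10 i hi
  refine ⟨-s, ?_⟩
  have := npos hn
  rw [hs, zpow_neg]
  field_simp

/-- affinity on pieces -/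
def AffOn (m : ℕ) (t u : ℕ → ℝ) (F : ℝ → ℝ) : Prop :=
  ∀ i, i < m → ∀ s, 0 ≤ s → s ≤ 1 → F (t i + s * (t (i + 1) - t i)) = u i + s * (u (i + 1) - u i)

lemma AffOn.symm {m : ℕ} {t u : ℕ → ℝ} {F : ℝ ≃o ℝ} (h : AffOn m t u F) :
    AffOn m u t F.symm := by
  intro i hi s h0 h1
  rw [OrderIso.symm_apply_eq, h i hi s h0 h1]

lemma exists_piece {m : ℕ} {t : ℕ → ℝ} (h0 : t 0 = 0) (hm : t m = 1) {x : ℝ}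
    (hx0 : 0 ≤ x) (hx1 : x < 1) : ∃ i, i < m ∧ t i ≤ x ∧ x < t (i + 1) := by
  by_contra! hc
  have : ∀ i, i ≤ m → t i ≤ x := by
    intro i
    induction i with
    | zero => intro _; rw [h0]; exact hx0
    | succ k ih => intro hk; exact hc k (by omega) (ih (by omega))
  have := this m le_rfl
  linarith

lemma add_int_of_add_one {F : ℝ → ℝ} (h : ∀ x, F (x + 1) = F x + 1) (z : ℤ) (x : ℝ) :
    F (x + z) = F x + z := by
  induction z using Int.induction_on with
  | zero => simp
  | succ i ih => push_cast at *; rw [← add_assoc, h, ih]; ring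
  | pred i ih =>
    push_cast at *
    have := h (x + (-(i:ℝ) - 1))
    rw [show x + (-(i:ℝ) - 1) + 1 = x + -(i:ℝ) by ring, ih] at this
    linarith

lemma pieces_aff_nadic (hn : 2 ≤ n) {m : ℕ} {t u : ℕ → ℝ} (hp : Pieces n m t u) {F : ℝ → ℝ}
    (h : ∀ x, F (x + 1) = F x + 1) (ha : AffOn m t u F) {x : ℝ} (hx : IsNAdic n x) :
    IsNAdic n (F x) := by
  obtain ⟨h1, h2, h3, h4, h5, h6, h7, h8, h9, h10⟩ := hp
  have hxf : IsNAdic n (Int.fract x) := by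
    rw [← Int.self_sub_floor]; exact nadic_sub hn hx (nadic_int _)
  have : IsNAdic n (F (Int.fract x)) := by
    obtain ⟨i, hi, hi1, hi2⟩ := exists_piece h2 h3 (Int.fract_nonneg x) (Int.fract_lt_one x)
    obtain ⟨s, hs⟩ := h10 i hi
    have hpos : 0 < t (i + 1) - t i := by linarith
    have := ha i hi ((Int.fract x - t i) / (t (i + 1) - t i)) (by apply div_nonneg <;> linarith)
      (by rw [div_le_one hpos]; linarith)
    rw [div_mul_cancel₀ _ hpos.ne', hs, mul_comm _ (t (i+1) - t i), ← mul_assoc,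
      div_mul_cancel₀ _ hpos.ne', add_sub_cancel] at this
    rw [this]
    exact nadic_add hn (h9 i hi.le) (nadic_mul hn (nadic_sub hn hxf (h8 i hi.le)) (nadic_zpow s))
  have h' := add_int_of_add_one h ⌊x⌋ (Int.fract x)
  rw [Int.fract_add_floor] at h'
  rw [h']
  exact nadic_add hn this (nadic_int _)

lemma inT_of_pieces (hn : 2 ≤ n) {m : ℕ} {t u : ℕ → ℝ} (hp : Pieces n m t u) (F : ℝ ≃o ℝ)
    (h : ∀ x, F (x + 1) = F x + 1) (ha : AffOn m t u F) : InT n (circHomeo F h) := by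
  refine ⟨?_, F, F.strictMono, circHomeo_coe F h, h, ?_⟩
  · ext p
    obtain ⟨x, -, -, rfl⟩ := coe_surj p
    rw [coe_mem_nadic hn]
    constructor
    · rintro ⟨q, hq, he⟩
      obtain ⟨y, -, -, rfl⟩ := coe_surj q
      rw [coe_mem_nadic hn] at hq
      rw [circHomeo_coe] at he
      rw [← coe_mem_nadic hn, ← he, coe_mem_nadic hn]
      exact pieces_aff_nadic hn hp h ha hq
    · intro hx
      refine ⟨(F.symm x : ℝ), ?_, ?_⟩
      · rw [coe_mem_nadic hn]
        exact pieces_aff_nadic hn (hp.symm hn) (symm_add_one F h) ha.symm hx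
      · rw [circHomeo_coe]; simp
  · obtain ⟨h1, h2, h3, h4, h5, h6, h7, h8, h9, h10⟩ := hp
    have : ∀ i, ∃ s : ℤ, i < m → u (i + 1) - u i = (n : ℝ) ^ s * (t (i + 1) - t i) := by
      intro i
      by_cases hi : i < m
      · obtain ⟨s, hs⟩ := h10 i hi
        exact ⟨s, fun _ => hs⟩
      · exact ⟨0, fun h => absurd h hi⟩
    choose s hs using this
    refine ⟨m, t, s, fun i => u i - (n:ℝ) ^ (s i) * t i, h1, h2, h3, h6, h8, ?_⟩
    rintro i hi x ⟨hx1, hx2⟩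
    have hpos : 0 < t (i + 1) - t i := by linarith [h6 i hi]
    have := ha i hi ((x - t i) / (t (i + 1) - t i)) (by apply div_nonneg <;> linarith)
      (by rw [div_le_one hpos]; linarith)
    rw [div_mul_cancel₀ _ hpos.ne', hs i hi, mul_comm _ (t (i+1) - t i), ← mul_assoc,
      div_mul_cancel₀ _ hpos.ne', add_sub_cancel] at this
    rw [this]; ring

end basics



section interp
variable {n : ℕ}

/-- linear interpolation of an integer-indexed sequence -/
def J (p : ℤ → ℝ) (x : ℝ) : ℝ := p ⌊x⌋ + Int.fract x * (p (⌊x⌋ + 1) - p ⌊x⌋)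

lemma J_eq (p : ℤ → ℝ) (i : ℤ) {s : ℝ} (h0 : 0 ≤ s) (h1 : s ≤ 1) :
    J p (i + s) = p i + s * (p (i + 1) - p i) := by
  rcases h1.lt_or_eq with h1 | rfl
  · have hf : ⌊(i : ℝ) + s⌋ = i := by
      rw [Int.floor_eq_iff]; constructor <;> linarith
    unfold J
    rw [← Int.self_sub_floor, hf]; ring
  · have hf : ⌊(i : ℝ) + 1⌋ = i + 1 := by simp
    unfold J
    rw [← Int.self_sub_floor, hf]; push_cast; ring

lemma J_strictMono {p : ℤ → ℝ} (hp : StrictMono p) : StrictMono (J p) := by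
  have hlt : ∀ i : ℤ, p i < p (i + 1) := fun i => hp (by omega)
  intro x y hxy
  have hx0 := Int.fract_nonneg x
  have hx1 := Int.fract_lt_one x
  have hy0 := Int.fract_nonneg y
  rcases (Int.floor_mono hxy.le).lt_or_eq with h | h
  · have h1 : p (⌊x⌋ + 1) ≤ p ⌊y⌋ := hp.monotone (by omega)
    unfold J
    nlinarith [hlt ⌊x⌋, hlt ⌊y⌋, mul_nonneg hy0 (sub_nonneg.2 (hlt ⌊y⌋).le)]
  · unfold J
    rw [← Int.self_sub_floor, ← Int.self_sub_floor, ← h]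
    have := hlt ⌊x⌋
    nlinarith

lemma J_surj {p : ℤ → ℝ} (hp : StrictMono p) (hlow : ∀ y : ℝ, ∃ i, p i ≤ y)
    (hup : ∀ y : ℝ, ∃ i, y < p i) : Function.Surjective (J p) := by
  intro y
  obtain ⟨b, hb⟩ := hup y
  obtain ⟨i, hi, hmax⟩ := Int.exists_greatest_of_bdd (P := fun i => p i ≤ y)
    ⟨b, fun z hz => (hp.lt_iff_lt.1 (lt_of_le_of_lt hz hb)).le⟩ (hlow y)
  have hi2 : y < p (i + 1) := by
    by_contra! hc
    have := hmax (i + 1) hc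
    omega
  have hpos : 0 < p (i + 1) - p i := by linarith
  refine ⟨i + (y - p i) / (p (i + 1) - p i), ?_⟩
  rw [J_eq p i (by apply div_nonneg <;> linarith) (by rw [div_le_one hpos]; linarith),
    div_mul_cancel₀ _ hpos.ne']
  ring

/-- periodic extension -/
def ext (m : ℕ) (t : ℕ → ℝ) (i : ℤ) : ℝ := (i / (m : ℤ) : ℤ) + t (i % (m : ℤ)).toNat

lemma ext_add (m : ℕ) (hm : 0 < m) (t : ℕ → ℝ) (i : ℤ) : ext m t (i + m) = ext m t i + 1 := by
  unfold ext
  rw [Int.add_emod_right, Int.add_ediv_of_dvd_right (dvd_refl _), Int.ediv_self (by omega)]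
  push_cast; ring

lemma ext_nat {m : ℕ} (hm : 0 < m) {t : ℕ → ℝ} (h0 : t 0 = 0) (h1 : t m = 1) {i : ℕ}
    (hi : i ≤ m) : ext m t i = t i := by
  unfold ext
  rcases hi.lt_or_eq with hi | rfl
  · rw [Int.ediv_eq_zero_of_lt (by omega) (by omega), Int.emod_eq_of_lt (by omega) (by omega)]
    simp
  · rw [Int.ediv_self (by omega), Int.emod_self]
    simp [h0, h1]

lemma ext_mul (m : ℕ) (hm : 0 < m) {t : ℕ → ℝ} (h0 : t 0 = 0) (k : ℤ) :
    ext m t (k * m) = k := by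
  unfold ext
  rw [Int.mul_ediv_cancel _ (by omega), Int.mul_emod_left]
  simp [h0]

lemma ext_strictMono {m : ℕ} (hm : 0 < m) {t : ℕ → ℝ} (h0 : t 0 = 0) (h1 : t m = 1)
    (ht : ∀ i, i < m → t i < t (i + 1)) : StrictMono (ext m t) := by
  apply strictMono_int_of_lt_succ
  intro i
  have key : ∀ (q : ℤ) (j : ℕ), j ≤ m → ext m t (j + q * m) = t j + q := by
    intro q j hj
    have : ∀ q : ℤ, ext m t (j + q * m) = ext m t j + q := by
      intro q
      unfold ext
      rw [Int.add_mul_emod_self_right, Int.add_mul_ediv_right _ _ (by omega)]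
      push_cast; ring
    rw [this, ext_nat hm h0 h1 hj]
  have hm' : (0:ℤ) < m := by omega
  have e1 := Int.emod_add_ediv_mul i m
  have e2 := Int.emod_nonneg i hm'.ne'
  have e3 := Int.emod_lt_of_pos i hm'
  obtain ⟨j, hj⟩ := Int.eq_ofNat_of_zero_le e2
  rw [hj] at e1 e3
  rw [← e1, key _ j (by omega), show ((j:ℤ) + i / m * m + 1) = ((j + 1 : ℕ) : ℤ) + i / m * m by
    push_cast; ring, key _ (j + 1) (by omega)]
  linarith [ht j (by omega)]

lemma exists_J_iso {m : ℕ} (hm : 0 < m) {t : ℕ → ℝ} (h0 : t 0 = 0) (h1 : t m = 1)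
    (ht : ∀ i, i < m → t i < t (i + 1)) : ∃ P : ℝ ≃o ℝ, (∀ x, P (x + m) = P x + 1) ∧
      ∀ i : ℕ, i < m → ∀ s, 0 ≤ s → s ≤ 1 → P (i + s) = t i + s * (t (i + 1) - t i) := by
  have hs := ext_strictMono hm h0 h1 ht
  have hsurj : Function.Surjective (J (ext m t)) := by
    apply J_surj hs
    · intro y; exact ⟨⌊y⌋ * m, by rw [ext_mul m hm h0]; exact Int.floor_le y⟩
    · intro y; exact ⟨(⌊y⌋ + 1) * m, by
        rw [ext_mul m hm h0]; push_cast; exact Int.lt_floor_add_one y⟩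
  refine ⟨(J_strictMono hs).orderIsoOfSurjective _ hsurj, ?_, ?_⟩
  · intro x
    change J _ _ = J _ _ + 1
    unfold J
    rw [Int.floor_add_natCast, Int.fract_add_natCast, ext_add m hm,
      show ⌊x⌋ + (m:ℤ) + 1 = ⌊x⌋ + 1 + m by ring, ext_add m hm]
    ring
  · intro i hi s hs0 hs1
    change J _ _ = _
    have := J_eq (ext m t) i hs0 hs1
    rw [ext_nat hm h0 h1 hi.le, show ((i:ℤ) + 1) = ((i + 1 : ℕ) : ℤ) by push_cast; ring,
      ext_nat hm h0 h1 hi] at this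
    simpa using this

lemma exists_homeo (hn : 2 ≤ n) {m : ℕ} {t u : ℕ → ℝ} (hp : Pieces n m t u) :
    ∃ f : Circle ≃ₜ Circle, InT n f ∧ InT n f⁻¹ ∧
      ∀ i, i < m → ∀ s : ℝ, 0 ≤ s → s ≤ 1 →
        f ((t i + s * (t (i + 1) - t i) : ℝ) : Circle) =
          ((u i + s * (u (i + 1) - u i) : ℝ) : Circle) := by
  obtain ⟨h1, h2, h3, h4, h5, h6, h7, h8, h9, h10⟩ := id hp
  obtain ⟨P, hP1, hP2⟩ := exists_J_iso h1 h2 h3 h6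
  obtain ⟨Q, hQ1, hQ2⟩ := exists_J_iso h1 h4 h5 h7
  have hF : ∀ x, (P.symm.trans Q) (x + 1) = (P.symm.trans Q) x + 1 := by
    intro x
    simp only [OrderIso.trans_apply]
    rw [← hQ1]
    congr 1
    rw [OrderIso.symm_apply_eq, hP1]; simp
  have ha : AffOn m t u (P.symm.trans Q) := by
    intro i hi s hs0 hs1
    rw [← hP2 i hi s hs0 hs1, ← hQ2 i hi s hs0 hs1]; simp
  refine ⟨circHomeo _ hF, inT_of_pieces hn hp _ hF ha, ?_, ?_⟩
  · rw [circHomeo_inv]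
    exact inT_of_pieces hn (hp.symm hn) _ _ ha.symm
  · intro i hi s hs0 hs1
    rw [circHomeo_coe, ha i hi s hs0 hs1]

end interp



section spine
variable {n : ℕ}

/-- linear interpolation of a sequence, on the half line -/
def L (p : ℕ → ℝ) (x : ℝ) : ℝ := p ⌊x⌋₊ + (x - ⌊x⌋₊) * (p (⌊x⌋₊ + 1) - p ⌊x⌋₊)

lemma L_eq (p : ℕ → ℝ) (i : ℕ) {s : ℝ} (h0 : 0 ≤ s) (h1 : s ≤ 1) :
    L p (i + s) = p i + s * (p (i + 1) - p i) := by
  rcases h1.lt_or_eq with h1 | rfl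
  · have hf : ⌊(i : ℝ) + s⌋₊ = i := by
      rw [Nat.floor_eq_iff (by positivity)]; constructor <;> linarith
    unfold L
    rw [hf]; ring
  · have hf : ⌊(i : ℝ) + 1⌋₊ = i + 1 := by
      rw [Nat.floor_eq_iff (by positivity)]; push_cast; constructor <;> linarith
    unfold L
    rw [hf]; push_cast; ring

lemma L_nat (p : ℕ → ℝ) (i : ℕ) : L p i = p i := by
  have := L_eq p i le_rfl zero_le_one
  simpa using this

lemma decomp {x : ℝ} (hx : 0 ≤ x) : ∃ i : ℕ, ∃ s : ℝ, 0 ≤ s ∧ s < 1 ∧ x = i + s := by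
  refine ⟨⌊x⌋₊, x - ⌊x⌋₊, ?_, ?_, by ring⟩
  · linarith [Nat.floor_le hx]
  · linarith [Nat.lt_floor_add_one x]

/-- the infinite right spine -/
def spine (n : ℕ) (j : ℕ) : ℝ :=
  1 - (1 - ((j % (n - 1) : ℕ) : ℝ) / n) / (n : ℝ) ^ (j / (n - 1))

lemma spine_small (hn : 2 ≤ n) {i : ℕ} (hi : i ≤ n - 1) : spine n i = (i : ℝ) / n := by
  have := npos hn
  rcases hi.lt_or_eq with h | h
  · unfold spine
    rw [Nat.mod_eq_of_lt h, Nat.div_eq_of_lt h]; simp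
  · unfold spine
    rw [h, Nat.mod_self, Nat.div_self (by omega), Nat.cast_sub (by omega)]
    field_simp
    simp
    ring

lemma spine_add (hn : 2 ≤ n) (i : ℕ) : spine n (i + (n - 1)) = 1 - (1 - spine n i) / n := by
  have := npos hn
  unfold spine
  rw [Nat.add_mod_right, Nat.add_div_right _ (by omega), pow_succ]
  field_simp
  ring

lemma spine_zero (hn : 2 ≤ n) : spine n 0 = 0 := by rw [spine_small hn (by omega)]; simp

lemma spine_add_mul (hn : 2 ≤ n) (a i : ℕ) :
    spine n (a * (n - 1) + i) = 1 - (1 - spine n i) / (n:ℝ) ^ a := by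
  have := npos hn
  induction a with
  | zero => simp
  | succ a ih =>
    rw [show (a + 1) * (n - 1) + i = a * (n - 1) + i + (n - 1) by ring, spine_add hn, ih, pow_succ]
    field_simp
    ring

lemma spine_diff (hn : 2 ≤ n) (i : ℕ) : ∃ d : ℕ, ∃ a : ℤ, spine n i = (a : ℝ) / (n:ℝ) ^ d ∧
    spine n (i + 1) = ((a : ℝ) + 1) / (n:ℝ) ^ d := by
  have := npos hn
  induction i using Nat.strong_induction_on with
  | _ i ih =>
    by_cases h : i < n - 1
    · refine ⟨1, i, ?_, ?_⟩
      · rw [spine_small hn h.le]; simp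
      · rw [spine_small hn h]; simp
    · obtain ⟨d, a, h1, h2⟩ := ih (i - (n - 1)) (by omega)
      obtain ⟨k, rfl⟩ : ∃ k, i = k + (n - 1) := ⟨i - (n - 1), by omega⟩
      rw [Nat.add_sub_cancel] at h1 h2
      refine ⟨d + 1, n ^ (d + 1) - n ^ d + a, ?_, ?_⟩
      · rw [spine_add hn, h1]; push_cast; field_simp; ring
      · rw [show k + (n - 1) + 1 = k + 1 + (n - 1) by ring, spine_add hn, h2]
        push_cast; field_simp; ring

lemma spine_lt (hn : 2 ≤ n) (i : ℕ) : spine n i < spine n (i + 1) := by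
  have := npos hn
  obtain ⟨d, a, h1, h2⟩ := spine_diff hn i
  rw [h1, h2]
  gcongr
  linarith

lemma spine_mono (hn : 2 ≤ n) : StrictMono (spine n) := strictMono_nat_of_lt_succ (spine_lt hn)

lemma spine_nonneg (hn : 2 ≤ n) (i : ℕ) : 0 ≤ spine n i := by
  rw [← spine_zero hn]; exact (spine_mono hn).monotone (Nat.zero_le i)

lemma spine_lt_one (hn : 2 ≤ n) (i : ℕ) : spine n i < 1 := by
  have := npos hn
  have hlt : ((i % (n - 1) : ℕ) : ℝ) < n := by
    have := Nat.mod_lt i (show n - 1 > 0 by omega)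
    exact_mod_cast (by omega : i % (n - 1) < n)
  unfold spine
  have : 0 < 1 - ((i % (n - 1) : ℕ) : ℝ) / n := by
    rw [sub_pos, div_lt_one this]; exact hlt
  have := div_pos this (pow_pos (npos hn) (i / (n-1)))
  linarith

lemma L_spine_surj (hn : 2 ≤ n) {y : ℝ} (h0 : 0 ≤ y) (h1 : y < 1) :
    ∃ x, 0 ≤ x ∧ L (spine n) x = y := by
  have hp := npos hn
  have hn1 : (1:ℝ) < n := by exact_mod_cast (by omega : 1 < n)
  have key : ∀ q : ℕ, ∀ y : ℝ, 0 ≤ y → y ≤ 1 - 1 / (n:ℝ) ^ q → ∃ x, 0 ≤ x ∧ L (spine n) x = y := by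
    intro q
    induction q with
    | zero =>
      intro y h0 h1
      refine ⟨0, le_rfl, ?_⟩
      have := L_nat (spine n) 0
      rw [spine_zero hn] at this
      simp at this h1
      rw [this]; linarith
    | succ q ih =>
      intro y h0 h1
      by_cases hy : y < 1 - 1 / n
      · obtain ⟨i, s, hs0, hs1, he⟩ := decomp (mul_nonneg hp.le h0)
        refine ⟨n * y, by positivity, ?_⟩
        have hny : (n:ℝ) * y < n - 1 := by
          have := mul_lt_mul_of_pos_left hy hp
          rwa [mul_sub, mul_one, mul_one_div_cancel hp.ne'] at this
        have hi : i + 1 < n := by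
          have : ((i + 1 : ℕ) : ℝ) < n := by push_cast; linarith
          exact_mod_cast this
        rw [he, L_eq _ _ hs0 hs1.le, spine_small hn (by omega), spine_small hn (by omega)]
        push_cast
        have : y = (i + s) / n := by rw [← he]; field_simp
        rw [this]; field_simp; ring
      · obtain ⟨x, hx0, hx⟩ := ih (1 - n * (1 - y)) (by
          have : 1 - y ≤ 1 / n := by linarith
          have := mul_le_mul_of_nonneg_left this hp.le
          rw [mul_one_div_cancel hp.ne'] at this
          linarith) (by
          have : 1 / (n:ℝ) ^ (q + 1) ≤ 1 - y := by linarith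
          have := mul_le_mul_of_nonneg_left this hp.le
          rw [pow_succ] at this
          have e : (n:ℝ) * (1 / (n ^ q * n)) = 1 / n ^ q := by field_simp
          rw [e] at this
          linarith)
        refine ⟨x + (n - 1 : ℕ), by positivity, ?_⟩
        obtain ⟨i, s, hs0, hs1, rfl⟩ := decomp hx0
        rw [show (i:ℝ) + s + (n - 1 : ℕ) = (i + (n - 1) : ℕ) + s by push_cast; ring,
          L_eq _ _ hs0 hs1.le, show i + (n - 1) + 1 = i + 1 + (n - 1) by ring, spine_add hn,
          spine_add hn]
        rw [L_eq _ _ hs0 hs1.le] at hx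
        field_simp
        linarith
  obtain ⟨q, hq⟩ := exists_pow_lt_of_lt_one (show 0 < 1 - y by linarith)
    (show 1 / (n:ℝ) < 1 by rw [div_lt_one hp]; exact hn1)
  apply key q y h0
  rw [div_pow, one_pow] at hq
  linarith

/-- the standard generators in the half-line model -/
def Fj (n j : ℕ) (x : ℝ) : ℝ :=
  if x ≤ j then x else if x ≤ j + 1 then j + n * (x - j) else x + (n - 1)

lemma L_Fj (hn : 2 ≤ n) (p : ℕ → ℝ) (j : ℕ)
    (hp : ∀ k : ℕ, k ≤ n → p (j + k) = p j + k * (p (j + n) - p j) / n) {x : ℝ} (hx : 0 ≤ x) :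
    L p (Fj n j x) = L (fun i => if i ≤ j then p i else p (i + (n - 1))) x := by
  have hpn := npos hn
  obtain ⟨i, s, hs0, hs1, rfl⟩ := decomp hx
  rw [L_eq _ _ hs0 hs1.le]
  rcases lt_trichotomy i j with h | rfl | h
  · have : (i:ℝ) + 1 ≤ j := by exact_mod_cast h
    rw [Fj, if_pos (by linarith), L_eq _ _ hs0 hs1.le, if_pos h.le, if_pos (by omega)]
  · have hF : Fj n i (i + s) = i + n * s := by
      unfold Fj
      split_ifs with h1 h2
      · have : s = 0 := by linarith
        simp [this]
      · ring
      · linarith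
    rw [hF, if_pos le_rfl, if_neg (by omega), show i + 1 + (n - 1) = i + n by omega]
    obtain ⟨k, r, hr0, hr1, he⟩ := decomp (mul_nonneg hpn.le hs0)
    have hk : k < n := by
      have : (k:ℝ) < n := by nlinarith
      exact_mod_cast this
    rw [he, show (i:ℝ) + (k + r) = (i + k : ℕ) + r by push_cast; ring, L_eq _ _ hr0 hr1.le,
      hp k hk.le, show i + k + 1 = i + (k + 1) by ring, hp (k + 1) hk]
    have : s = (k + r) / n := by rw [← he]; field_simp
    rw [this]; push_cast; field_simp; ring
  · have : (j:ℝ) + 1 ≤ i := by exact_mod_cast h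
    have hF : Fj n j (i + s) = (i + (n - 1) : ℕ) + s := by
      rw [Nat.cast_add, Nat.cast_sub (by omega)]
      unfold Fj
      split_ifs with h1 h2
      · linarith
      · have h1 : (i:ℝ) = j + 1 := by linarith
        have h2 : s = 0 := by linarith
        rw [h1, h2]; push_cast; ring
      · push_cast; ring
    rw [hF, L_eq _ _ hs0 hs1.le, if_neg (by omega), if_neg (by omega),
      show i + (n - 1) + 1 = i + 1 + (n - 1) by ring]

lemma Fj_nonneg (hn : 2 ≤ n) (j : ℕ) {x : ℝ} (hx : 0 ≤ x) : 0 ≤ Fj n j x := by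
  have : (2:ℝ) ≤ n := by exact_mod_cast hn
  have : (0:ℝ) ≤ j := by positivity
  unfold Fj
  split_ifs with h1 h2
  · exact hx
  · nlinarith
  · linarith

lemma Fj_surj (hn : 2 ≤ n) (j : ℕ) {y : ℝ} (hy : 0 ≤ y) : ∃ x, 0 ≤ x ∧ Fj n j x = y := by
  have h2 : (2:ℝ) ≤ n := by exact_mod_cast hn
  have hj : (0:ℝ) ≤ j := by positivity
  have hpn := npos hn
  by_cases h1 : y ≤ j
  · exact ⟨y, hy, by rw [Fj, if_pos h1]⟩
  · push Not at h1
    by_cases h3 : y ≤ j + n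
    · refine ⟨j + (y - j) / n, by have := div_nonneg (sub_nonneg.2 h1.le) hpn.le; linarith, ?_⟩
      have ha : 0 < (y - j) / n := div_pos (by linarith) hpn
      have hb : (y - j) / n ≤ 1 := by rw [div_le_one hpn]; linarith
      rw [Fj, if_neg (by linarith), if_pos (by linarith)]
      field_simp; ring
    · push Not at h3
      refine ⟨y - (n - 1), by linarith, ?_⟩
      rw [Fj, if_neg (by linarith), if_neg (by linarith)]; ring

lemma Fj_rel (hn : 2 ≤ n) {j : ℕ} (hj : 1 ≤ j) {x : ℝ} (hx : 0 ≤ x) :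
    Fj n 0 (Fj n j x) = Fj n (j + (n - 1)) (Fj n 0 x) := by
  have h2 : (2:ℝ) ≤ n := by exact_mod_cast hn
  have hj : (1:ℝ) ≤ j := by exact_mod_cast hj
  unfold Fj
  rw [Nat.cast_add, Nat.cast_sub (by omega)]
  push_cast
  by_cases a : x ≤ 0
  · have : x = 0 := le_antisymm a hx
    subst this
    have h3 : (0:ℝ) ≤ j := by linarith
    have h4 : (0:ℝ) ≤ j + (n - 1) := by linarith
    simp [h4]
  by_cases b : x ≤ 1
  · have c : x ≤ j := by linarith
    rw [if_pos c, if_neg a, if_pos (by linarith), if_pos (by nlinarith)]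
  · rw [if_neg a, if_neg (by linarith : ¬ x ≤ 0 + 1)]
    by_cases c : x ≤ j
    · rw [if_pos c, if_neg a, if_neg (by linarith), if_pos (by linarith)]
    · rw [if_neg c, if_neg (by linarith : ¬ x + (n - 1) ≤ j + ((n:ℝ) - 1))]
      by_cases d : x ≤ j + 1
      · rw [if_pos d, if_neg (by nlinarith), if_neg (by nlinarith), if_pos (by linarith)]
        ring
      · rw [if_neg d, if_neg (by linarith), if_neg (by linarith), if_neg (by linarith)]

end spine



section gens
variable {n : ℕ}

/-- tail condition: from index `K` on, the sequence subdivides the last interval by a spine -/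
def Tail (n : ℕ) (p : ℕ → ℝ) (K e : ℕ) : Prop :=
  ∀ i, p (K + i) = 1 - (1 - spine n i) / (n:ℝ) ^ e

/-- the spine with its `j`-th interval subdivided -/
def subSpine (n j : ℕ) (i : ℕ) : ℝ :=
  if i ≤ j then spine n i
  else if i ≤ j + n then spine n j + ((i:ℝ) - j) * (spine n (j + 1) - spine n j) / n
  else spine n (i - (n - 1))

lemma exists_of_tail (hn : 2 ≤ n) {p q : ℕ → ℝ} {K e e' : ℕ} (hp0 : p 0 = 0) (hq0 : q 0 = 0)
    (hp : Tail n p K e) (hq : Tail n q K e')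
    (hpm : ∀ i, i < K → p i < p (i + 1)) (hqm : ∀ i, i < K → q i < q (i + 1))
    (hpa : ∀ i, i ≤ K → IsNAdic n (p i)) (hqa : ∀ i, i ≤ K → IsNAdic n (q i))
    (hs : ∀ i, i < K → ∃ s : ℤ, q (i + 1) - q i = (n : ℝ) ^ s * (p (i + 1) - p i)) :
    ∃ f : Circle ≃ₜ Circle, InT n f ∧ InT n f⁻¹ ∧ ∀ x : ℝ, 0 ≤ x →
      f ((L p x : ℝ) : Circle) = ((L q x : ℝ) : Circle) := by
  have hpn := npos hn
  have hpK : p K = 1 - 1 / (n:ℝ) ^ e := by have := hp 0; simpa [spine_zero hn] using this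
  have hqK : q K = 1 - 1 / (n:ℝ) ^ e' := by have := hq 0; simpa [spine_zero hn] using this
  have hposp : 0 < 1 / (n:ℝ) ^ e := by positivity
  have hposq : 0 < 1 / (n:ℝ) ^ e' := by positivity
  let t : ℕ → ℝ := fun i => if i ≤ K then p i else 1
  let u : ℕ → ℝ := fun i => if i ≤ K then q i else 1
  have ht1 : ∀ i, i ≤ K → t i = p i := fun i h => if_pos h
  have hu1 : ∀ i, i ≤ K → u i = q i := fun i h => if_pos h
  have ht2 : t (K + 1) = 1 := if_neg (by omega)
  have hu2 : u (K + 1) = 1 := if_neg (by omega)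
  have hP : Pieces n (K + 1) t u := by
    refine ⟨by omega, ?_, ht2, ?_, hu2, ?_, ?_, ?_, ?_, ?_⟩
    · rw [ht1 _ (by omega), hp0]
    · rw [hu1 _ (by omega), hq0]
    · intro i hi
      rcases Nat.lt_succ_iff_lt_or_eq.1 hi with h | rfl
      · rw [ht1 _ h.le, ht1 _ h]; exact hpm i h
      · rw [ht1 _ le_rfl, ht2, hpK]; linarith
    · intro i hi
      rcases Nat.lt_succ_iff_lt_or_eq.1 hi with h | rfl
      · rw [hu1 _ h.le, hu1 _ h]; exact hqm i h
      · rw [hu1 _ le_rfl, hu2, hqK]; linarith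
    · intro i hi
      rcases Nat.le_succ_iff.1 hi with h | rfl
      · rw [ht1 _ h]; exact hpa i h
      · rw [ht2]; simpa using nadic_int (n := n) 1
    · intro i hi
      rcases Nat.le_succ_iff.1 hi with h | rfl
      · rw [hu1 _ h]; exact hqa i h
      · rw [hu2]; simpa using nadic_int (n := n) 1
    · intro i hi
      rcases Nat.lt_succ_iff_lt_or_eq.1 hi with h | rfl
      · rw [ht1 _ h.le, ht1 _ h, hu1 _ h.le, hu1 _ h]; exact hs i h
      · refine ⟨(e:ℤ) - e', ?_⟩
        rw [ht1 _ le_rfl, hu1 _ le_rfl, ht2, hu2, hpK, hqK, zpow_sub₀ hpn.ne', zpow_natCast,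
          zpow_natCast]
        field_simp
        ring
  obtain ⟨f, hf1, hf2, hf⟩ := exists_homeo hn hP
  refine ⟨f, hf1, hf2, fun x hx => ?_⟩
  obtain ⟨i, s, hs0, hs1, rfl⟩ := decomp hx
  rw [L_eq _ _ hs0 hs1.le, L_eq _ _ hs0 hs1.le]
  by_cases h : i < K
  · have := hf i (by omega) s hs0 hs1.le
    rwa [ht1 _ h.le, ht1 _ h, hu1 _ h.le, hu1 _ h] at this
  · obtain ⟨k, rfl⟩ : ∃ k, i = K + k := ⟨i - K, by omega⟩
    have a0 := spine_nonneg hn k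
    have a1 := spine_lt_one hn k
    have b0 := spine_nonneg hn (k + 1)
    have b1 := spine_lt_one hn (k + 1)
    have := hf K (by omega) (spine n k + s * (spine n (k + 1) - spine n k)) (by nlinarith)
      (by nlinarith)
    rw [ht1 _ le_rfl, hu1 _ le_rfl, ht2, hu2, hpK, hqK] at this
    rw [show K + k + 1 = K + (k + 1) by ring, hp, hp, hq, hq]
    have key : ∀ E : ℕ, 1 - (1 - spine n k) / (n:ℝ) ^ E + s * (1 - (1 - spine n (k + 1)) / (n:ℝ) ^ E -
        (1 - (1 - spine n k) / (n:ℝ) ^ E)) = 1 - 1 / (n:ℝ) ^ E +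
        (spine n k + s * (spine n (k + 1) - spine n k)) * (1 - (1 - 1 / (n:ℝ) ^ E)) := by
      intro E; field_simp; ring
    rw [key e, key e']
    exact this

lemma subSpine_small {j i : ℕ} (h : i ≤ j) : subSpine n j i = spine n i := if_pos h

lemma subSpine_mid {j k : ℕ} (h : k ≤ n) :
    subSpine n j (j + k) = spine n j + k * (spine n (j + 1) - spine n j) / n := by
  unfold subSpine
  split_ifs with h1 h2
  · have : k = 0 := by omega
    simp [this]
  · push_cast; ring
  · omega

lemma subSpine_big (hn : 2 ≤ n) {j i : ℕ} (h : j < i) : subSpine n j (i + (n - 1)) = spine n i := by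
  unfold subSpine
  have := npos hn
  split_ifs with h1 h2
  · omega
  · have : i = j + 1 := by omega
    subst this
    rw [show j + 1 + (n - 1) = j + n by omega]
    push_cast
    field_simp
    ring
  · congr 1; omega

lemma subSpine_diff (hn : 2 ≤ n) (j i : ℕ) : ∃ d : ℕ, ∃ a : ℤ,
    subSpine n j i = (a : ℝ) / (n:ℝ) ^ d ∧ subSpine n j (i + 1) = ((a : ℝ) + 1) / (n:ℝ) ^ d := by
  have := npos hn
  by_cases h1 : i < j
  · rw [subSpine_small h1.le, subSpine_small h1]; exact spine_diff hn i
  · obtain ⟨k, rfl⟩ : ∃ k, i = j + k := ⟨i - j, by omega⟩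
    by_cases h2 : k < n
    · obtain ⟨d, a, ha, hb⟩ := spine_diff hn j
      refine ⟨d + 1, a * n + k, ?_, ?_⟩
      · rw [subSpine_mid h2.le, ha, hb]; push_cast; field_simp; ring
      · rw [add_assoc, subSpine_mid h2, ha, hb]; push_cast; field_simp; ring
    · obtain ⟨l, hl⟩ : ∃ l, j + k = l + (n - 1) := ⟨j + k - (n - 1), by omega⟩
      rw [hl, show l + (n - 1) + 1 = l + 1 + (n - 1) by ring, subSpine_big hn (by omega),
        subSpine_big hn (by omega)]
      exact spine_diff hn l

/-- `g` is the `j`-th standard generator -/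
def IsX (n j : ℕ) (g : Circle ≃ₜ Circle) : Prop :=
  ∀ x : ℝ, 0 ≤ x → g ((L (spine n) x : ℝ) : Circle) = ((L (spine n) (Fj n j x) : ℝ) : Circle)

lemma exists_X (hn : 2 ≤ n) (j : ℕ) : ∃ g : Circle ≃ₜ Circle, InT n g ∧ InT n g⁻¹ ∧ IsX n j g := by
  have hpn := npos hn
  have ht : Tail n (subSpine n j) ((j + 2) * (n - 1)) (j + 1) := by
    intro i
    have h : j + 1 ≤ (j + 1) * (n - 1) := Nat.le_mul_of_pos_right _ (by omega)
    rw [show (j + 2) * (n - 1) + i = ((j + 1) * (n - 1) + i) + (n - 1) by ring,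
      subSpine_big hn (by omega), spine_add_mul hn]
  have hd : ∀ (p : ℕ → ℝ), (∀ i, ∃ d : ℕ, ∃ a : ℤ, p i = (a : ℝ) / (n:ℝ) ^ d ∧
      p (i + 1) = ((a : ℝ) + 1) / (n:ℝ) ^ d) → (∀ i, p i < p (i + 1)) ∧ (∀ i, IsNAdic n (p i)) ∧
      ∀ i, ∃ d : ℕ, p (i + 1) - p i = 1 / (n:ℝ) ^ d := by
    intro p h
    refine ⟨fun i => ?_, fun i => ?_, fun i => ?_⟩
    · obtain ⟨d, a, h1, h2⟩ := h i
      rw [h1, h2]; gcongr; linarith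
    · obtain ⟨d, a, h1, h2⟩ := h i
      exact ⟨a, d, h1⟩
    · obtain ⟨d, a, h1, h2⟩ := h i
      exact ⟨d, by rw [h1, h2]; ring⟩
  obtain ⟨p1, p2, p3⟩ := hd _ (subSpine_diff hn j)
  obtain ⟨q1, q2, q3⟩ := hd _ (spine_diff hn)
  obtain ⟨f, hf1, hf2, hf⟩ := exists_of_tail hn
    (by rw [subSpine_small (Nat.zero_le _), spine_zero hn]) (spine_zero hn) ht
    (fun i => spine_add_mul hn (j + 2) i) (fun i _ => p1 i) (fun i _ => q1 i) (fun i _ => p2 i)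
    (fun i _ => q2 i) (fun i _ => by
      obtain ⟨d, hd⟩ := p3 i
      obtain ⟨d', hd'⟩ := q3 i
      refine ⟨(d:ℤ) - d', ?_⟩
      rw [hd, hd', zpow_sub₀ hpn.ne', zpow_natCast, zpow_natCast]
      field_simp)
  refine ⟨f, hf1, hf2, fun x hx => ?_⟩
  rw [← hf _ (Fj_nonneg hn j hx), L_Fj hn _ j _ hx]
  · congr 4
    funext i
    split_ifs with h
    · rw [subSpine_small h]
    · rw [subSpine_big hn (by omega)]
  · intro k hk
    have h0 := subSpine_small (n := n) (le_refl j)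
    rw [subSpine_mid hk, subSpine_mid le_rfl, h0]
    field_simp
    ring

/-- rotation by `y` -/
def rot (y : ℝ) : Circle ≃ₜ Circle := circHomeo (OrderIso.addRight y) (fun x => by simp; ring)

lemma rot_coe (y x : ℝ) : rot y (x : Circle) = ((x + y : ℝ) : Circle) := rfl

lemma rot_inv (y : ℝ) : (rot y)⁻¹ = rot (-y) := by
  rw [inv_eq_iff_mul_eq_one]
  apply Homeomorph.ext
  intro p
  obtain ⟨x, -, -, rfl⟩ := coe_surj p
  rw [hmul_apply, rot_coe, rot_coe, hone_apply]; simp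

lemma rot_inT (hn : 2 ≤ n) {y : ℝ} (hy : IsNAdic n y) : InT n (rot y) := by
  refine ⟨?_, fun x => x + y, fun a b h => by simpa using h, rot_coe y, ?_, ?_⟩
  · ext p
    obtain ⟨x, -, -, rfl⟩ := coe_surj p
    rw [coe_mem_nadic hn]
    constructor
    · rintro ⟨q, hq, he⟩
      obtain ⟨z, -, -, rfl⟩ := coe_surj q
      rw [coe_mem_nadic hn] at hq
      rw [rot_coe] at he
      rw [← coe_mem_nadic hn, ← he, coe_mem_nadic hn]
      exact nadic_add hn hq hy
    · intro hx
      refine ⟨(x - y : ℝ), ?_, ?_⟩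
      · rw [coe_mem_nadic hn]
        exact nadic_sub hn hx hy
      · rw [rot_coe]; simp
  · intro x; ring
  · refine ⟨1, fun i => i, fun _ => 0, fun _ => y, by omega, by simp, by simp, by simp, ?_, ?_⟩
    · intro i _; simpa using nadic_int (n := n) i
    · intro i _ x _; simp

end gens



section grid
variable {n : ℕ}

/-- `F` maps the intervals of the grid of mesh `n ^ (-N)` affinely to standard intervals. -/
def Grid (n : ℕ) (F : ℝ → ℝ) (N : ℕ) : Prop :=
  ∀ k : ℤ, ∃ a : ℤ, ∃ d : ℕ, ∀ s : ℝ, 0 ≤ s → s ≤ 1 →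
    F ((k + s) / (n:ℝ) ^ N) = (a + s) / (n:ℝ) ^ d

lemma Grid.refine (hn : 2 ≤ n) {F : ℝ → ℝ} {N : ℕ} (h : Grid n F N) (M : ℕ) (k : ℤ) :
    ∃ a : ℤ, ∃ d : ℕ, M ≤ d ∧ ∀ s : ℝ, 0 ≤ s → s ≤ 1 →
    F ((k + s) / (n:ℝ) ^ (N + M)) = (a + s) / (n:ℝ) ^ d := by
  have hpn := npos hn
  have hpos : (0:ℤ) < (n:ℤ) ^ M := by positivity
  obtain ⟨a, d, had⟩ := h (k / (n:ℤ) ^ M)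
  have e1 := Int.emod_add_mul_ediv k ((n:ℤ) ^ M)
  have e2 := Int.emod_nonneg k hpos.ne'
  have e3 := Int.emod_lt_of_pos k hpos
  set r := k % (n:ℤ) ^ M
  set q := k / (n:ℤ) ^ M
  refine ⟨a * n ^ M + r, d + M, by omega, fun s hs0 hs1 => ?_⟩
  have hr0 : (0:ℝ) ≤ r := by exact_mod_cast e2
  have hr1 : (r:ℝ) + 1 ≤ (n:ℝ) ^ M := by exact_mod_cast e3
  have := had ((r + s) / (n:ℝ) ^ M) (by positivity) (by
    rw [div_le_one (by positivity)]; linarith)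
  have ek : (k:ℝ) = r + n ^ M * q := by rw [← e1]; push_cast; ring
  rw [show ((k:ℝ) + s) / (n:ℝ) ^ (N + M) = (q + (r + s) / (n:ℝ) ^ M) / (n:ℝ) ^ N by
    rw [ek, pow_add]; field_simp; ring, this]
  push_cast
  rw [pow_add]; field_simp; ring

lemma Grid.mono (hn : 2 ≤ n) {F : ℝ → ℝ} {N M : ℕ} (h : Grid n F N) (hM : N ≤ M) : Grid n F M := by
  intro k
  obtain ⟨K, rfl⟩ := Nat.exists_eq_add_of_le hM
  obtain ⟨a, d, -, hd⟩ := h.refine hn K k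
  exact ⟨a, d, hd⟩

lemma Grid.comp (hn : 2 ≤ n) {F G : ℝ → ℝ} {N M : ℕ} (hF : Grid n F M) (hG : Grid n G N) :
    Grid n (F ∘ G) (N + M) := by
  intro k
  obtain ⟨a, d, hd, h⟩ := hG.refine hn M k
  obtain ⟨a', d', h'⟩ := hF.mono hn hd a
  refine ⟨a', d', fun s hs0 hs1 => ?_⟩
  rw [Function.comp_apply, h s hs0 hs1, h' s hs0 hs1]

lemma Grid.piecewise (hn : 2 ≤ n) {F : ℝ → ℝ} {N : ℕ} (h : Grid n F N)
    (h1 : ∀ x, F (x + 1) = F x + 1) : PiecewiseNAffine n F := by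
  have hpn := npos hn
  choose a d had using h
  refine ⟨h1, n ^ N, fun i => (i:ℝ) / (n:ℝ) ^ N, fun i => (N:ℤ) - d i,
    fun i => a i / (n:ℝ) ^ (d i) - i / (n:ℝ) ^ (d i), Nat.pow_pos (by omega), by simp, ?_, ?_, ?_, ?_⟩
  · push_cast; field_simp
  · intro i _; push_cast; gcongr; linarith
  · intro i _; exact ⟨i, N, by simp⟩
  · rintro i _ x ⟨hx0, hx1⟩
    have := had i (x * (n:ℝ) ^ N - i) (by rw [div_le_iff₀ (by positivity)] at hx0; linarith)
      (by rw [le_div_iff₀ (by positivity)] at hx1; push_cast at hx1; linarith)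
    rw [show (((i:ℤ):ℝ) + (x * (n:ℝ) ^ N - i)) / (n:ℝ) ^ N = x by push_cast; field_simp; ring] at this
    rw [this, zpow_sub₀ hpn.ne', zpow_natCast, zpow_natCast]
    field_simp
    ring

lemma exists_grid (hn : 2 ≤ n) {f : Circle ≃ₜ Circle} (hf : InT n f) :
    ∃ F : ℝ → ℝ, StrictMono F ∧ IsLift f F ∧ (∀ x, F (x + 1) = F x + 1) ∧ ∃ N, Grid n F N := by
  have hpn := npos hn
  obtain ⟨him, F, hF, hl, h1, m, t, sl, c, hm, ht0, htm, htl, hta, hc⟩ := hf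
  refine ⟨F, hF, hl, h1, ?_⟩
  have hca : ∀ i, i < m → IsNAdic n (c i) := by
    intro i hi
    have e := hc i hi (t i) ⟨le_rfl, (htl i hi).le⟩
    have hFt : IsNAdic n (F (t i)) := by
      rw [← coe_mem_nadic hn, ← hl, ← him]
      exact ⟨_, (coe_mem_nadic hn _).2 (hta i hi.le), rfl⟩
    have : c i = F (t i) - (n:ℝ) ^ (sl i) * t i := by linarith
    rw [this]
    exact nadic_sub hn hFt (nadic_mul hn (nadic_zpow _) (hta i hi.le))
  have ha : ∀ i, ∃ A : ℤ, ∃ k : ℕ, i ≤ m → t i = (A:ℝ) / (n:ℝ) ^ k := by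
    intro i
    by_cases h : i ≤ m
    · obtain ⟨A, k, e⟩ := hta i h; exact ⟨A, k, fun _ => e⟩
    · exact ⟨0, 0, fun h' => absurd h' h⟩
  have hb : ∀ i, ∃ A : ℤ, ∃ k : ℕ, i < m → c i = (A:ℝ) / (n:ℝ) ^ k := by
    intro i
    by_cases h : i < m
    · obtain ⟨A, k, e⟩ := hca i h; exact ⟨A, k, fun _ => e⟩
    · exact ⟨0, 0, fun h' => absurd h' h⟩
  choose A κ hA using ha
  choose C l hC using hb
  let B : ℕ → ℕ := fun i => κ i + l i + (sl i).natAbs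
  let N := ∑ i ∈ Finset.range (m + 1), B i
  have hN : ∀ i, i ≤ m → κ i + l i + (sl i).natAbs ≤ N := by
    intro i hi
    exact Finset.single_le_sum (f := B) (fun _ _ => Nat.zero_le _) (Finset.mem_range.2 (by omega))
  refine ⟨N, fun k => ?_⟩
  have hpos : (0:ℤ) < (n:ℤ) ^ N := by positivity
  have e1 := Int.emod_add_mul_ediv k ((n:ℤ) ^ N)
  have e2 := Int.emod_nonneg k hpos.ne'
  have e3 := Int.emod_lt_of_pos k hpos
  set r := k % (n:ℤ) ^ N
  set q := k / (n:ℤ) ^ N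
  have hr0 : (0:ℝ) ≤ r := by exact_mod_cast e2
  have hr1 : (r:ℝ) < (n:ℝ) ^ N := by exact_mod_cast e3
  have hNpos : (0:ℝ) < (n:ℝ) ^ N := by positivity
  obtain ⟨i, hi, hi1, hi2⟩ := exists_piece ht0 htm (x := r / (n:ℝ) ^ N) (by positivity)
    (by rw [div_lt_one hNpos]; exact hr1)
  have hi3 : ((r:ℝ) + 1) / (n:ℝ) ^ N ≤ t (i + 1) := by
    have hk := hN (i + 1) hi
    obtain ⟨w, hw⟩ := Nat.exists_eq_add_of_le (show κ (i + 1) ≤ N by omega)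
    have e : t (i + 1) = ((A (i + 1) * n ^ w : ℤ) : ℝ) / (n:ℝ) ^ N := by
      rw [hA _ hi, hw, pow_add]; push_cast; field_simp
    rw [e, div_lt_div_iff_of_pos_right hNpos] at hi2
    rw [e, div_le_div_iff_of_pos_right hNpos]
    exact_mod_cast (by exact_mod_cast hi2 : r < A (i + 1) * n ^ w)
  obtain ⟨d, hd⟩ := Int.eq_ofNat_of_zero_le (a := (N:ℤ) - sl i) (by have := hN i hi.le; omega)
  obtain ⟨w, hw⟩ := Nat.exists_eq_add_of_le (show l i ≤ d by have := hN i hi.le; omega)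
  refine ⟨r + C i * n ^ w + q * n ^ d, d, fun s hs0 hs1 => ?_⟩
  have ek : (k:ℝ) = r + n ^ N * q := by rw [← e1]; push_cast; ring
  rw [show ((k:ℝ) + s) / (n:ℝ) ^ N = (r + s) / (n:ℝ) ^ N + q by rw [ek]; field_simp; ring,
    add_int_of_add_one h1, hc i hi _ ⟨le_trans hi1 (by gcongr; linarith), le_trans (by gcongr) hi3⟩,
    hC i hi, show sl i = (N:ℤ) - d by omega, zpow_sub₀ hpn.ne', zpow_natCast, zpow_natCast]
  push_cast
  rw [hw, pow_add]
  field_simp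
  ring

lemma inT_mul (hn : 2 ≤ n) {f g : Circle ≃ₜ Circle} (hf : InT n f) (hg : InT n g) :
    InT n (f * g) := by
  obtain ⟨F, hF1, hF2, hF3, N, hF4⟩ := exists_grid hn hf
  obtain ⟨G, hG1, hG2, hG3, M, hG4⟩ := exists_grid hn hg
  refine ⟨?_, F ∘ G, hF1.comp hG1, ?_, (hF4.comp hn hG4).piecewise hn ?_⟩
  · have : (⇑(f * g) : Circle → Circle) = f ∘ g := rfl
    rw [this, Set.image_comp, hg.1, hf.1]
  · intro x
    rw [hmul_apply, hG2, hF2]; rfl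
  · intro x
    simp [hG3, hF3]

end grid



section generation
variable {n : ℕ}

/-- standard sequences -/
def Std (n : ℕ) (p : ℕ → ℝ) (K : ℕ) (d : ℕ → ℕ) : Prop :=
  p 0 = 0 ∧ (∀ j, j < K → ∃ a : ℤ, p j = (a:ℝ) / (n:ℝ) ^ (d j) ∧
    p (j + 1) = ((a:ℝ) + 1) / (n:ℝ) ^ (d j)) ∧ Tail n p K (d K)

lemma first_max (d : ℕ → ℕ) (K : ℕ) :
    ∃ j, j ≤ K ∧ (∀ i, i ≤ K → d i ≤ d j) ∧ ∀ i, i < j → d i < d j := by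
  induction K with
  | zero =>
    refine ⟨0, le_rfl, fun i hi => ?_, fun i hi => by omega⟩
    rw [Nat.le_zero.1 hi]
  | succ K ih =>
    obtain ⟨j, hj, h1, h2⟩ := ih
    by_cases h : d j < d (K + 1)
    · refine ⟨K + 1, le_rfl, fun i hi => ?_, fun i hi => ?_⟩
      · rcases Nat.le_succ_iff.1 hi with h' | rfl
        · exact (h1 i h').trans h.le
        · exact le_rfl
      · exact lt_of_le_of_lt (h1 i (by omega)) h
    · refine ⟨j, by omega, fun i hi => ?_, h2⟩
      rcases Nat.le_succ_iff.1 hi with h' | rfl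
      · exact h1 i h'
      · exact not_lt.1 h

lemma dvd_of_eq (hn : 2 ≤ n) {a b : ℤ} {D e : ℕ} (he : e < D)
    (h : (a:ℝ) / (n:ℝ) ^ D = (b:ℝ) / (n:ℝ) ^ e) : (n:ℤ) ∣ a := by
  have hpn := npos hn
  obtain ⟨w, rfl⟩ := Nat.exists_eq_add_of_lt he
  refine ⟨b * n ^ w, ?_⟩
  have : (a:ℝ) = n * (b * n ^ w) := by
    rw [pow_add, pow_add] at h
    field_simp at h
    linarith
  exact_mod_cast this

lemma std_gen (hn : 2 ≤ n) (H : Subgroup (Circle ≃ₜ Circle)) (hX : ∀ j, ∃ g ∈ H, IsX n j g) :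
    ∀ (K : ℕ) (p : ℕ → ℝ) (d : ℕ → ℕ), Std n p K d → ∃ g ∈ H, ∀ x : ℝ, 0 ≤ x →
      g ((L (spine n) x : ℝ) : Circle) = ((L p x : ℝ) : Circle) := by
  have hpn := npos hn
  intro K
  induction K using Nat.strong_induction_on with
  | _ K ih =>
  rintro p d ⟨h0, hd, ht⟩
  have hpK : p K = 1 - 1 / (n:ℝ) ^ (d K) := by have := ht 0; simpa [spine_zero hn] using this
  rcases Nat.eq_zero_or_pos K with rfl | hK
  · have : p = spine n := by
      funext i
      have h1 := ht i
      rw [h0] at hpK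
      have : (n:ℝ) ^ (d 0) = 1 := by field_simp at hpK; linarith
      rw [this] at h1
      simp at h1
      exact h1
    exact ⟨1, H.one_mem, fun x _ => by rw [this]; rfl⟩
  have hInt : ∀ i, i ≤ K → ∃ a : ℤ, p i = (a:ℝ) / (n:ℝ) ^ (d i) ∧
      (i < K → p (i + 1) = ((a:ℝ) + 1) / (n:ℝ) ^ (d i)) ∧ (i = K → a + 1 = (n:ℤ) ^ (d i)) := by
    intro i hi
    rcases hi.lt_or_eq with h | rfl
    · obtain ⟨a, h1, h2⟩ := hd i h
      exact ⟨a, h1, fun _ => h2, fun h' => by omega⟩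
    · refine ⟨n ^ (d i) - 1, ?_, fun h => by omega, fun _ => by ring⟩
      rw [hpK]; push_cast; field_simp
  obtain ⟨j, hj, hmax, hfirst⟩ := first_max d K
  generalize hD : d j = D at hmax hfirst
  have hD1 : 1 ≤ D := by
    by_contra hc
    have hz : ∀ i, i ≤ K → d i = 0 := fun i hi => by have := hmax i hi; omega
    have : ∀ i, i ≤ K → p i = i := by
      intro i
      induction i with
      | zero => intro _; simpa using h0
      | succ i ihi =>
        intro hi
        obtain ⟨a, h1, h2⟩ := hd i hi
        rw [hz i (by omega)] at h1 h2
        rw [ihi (by omega)] at h1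
        rw [h2]; push_cast; rw [h1]; simp
    have h1 := this K le_rfl
    rw [hpK, hz K le_rfl, pow_zero] at h1
    have h2 : (K:ℝ) = 0 := by linarith
    have h3 : K = 0 := by exact_mod_cast h2
    omega
  obtain ⟨a, ha, -, -⟩ := hInt j hj
  rw [hD] at ha
  have hdvd : (n:ℤ) ∣ a := by
    rcases Nat.eq_zero_or_pos j with hj0 | hj0
    · rw [hj0, h0] at ha
      have : (a:ℝ) = 0 := by field_simp at ha; simpa using ha.symm
      have : a = 0 := by exact_mod_cast this
      rw [this]; exact dvd_zero _
    · obtain ⟨b, -, hb, -⟩ := hInt (j - 1) (by omega)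
      have hb := hb (by omega)
      rw [Nat.sub_add_cancel hj0, ha] at hb
      exact dvd_of_eq hn (b := b + 1) (hfirst (j - 1) (by omega)) (by rw [hb]; push_cast; rfl)
  have hnd : ∀ k : ℕ, 0 < k → k < n → ¬ ((n:ℤ) ∣ a + k) := by
    intro k hk0 hkn h
    have := (Int.dvd_add_right hdvd).1 h
    have := Int.le_of_dvd (by omega) this
    omega
  have claim : ∀ k : ℕ, k < n → j + k ≤ K ∧ d (j + k) = D ∧
      p (j + k) = ((a:ℝ) + k) / (n:ℝ) ^ D := by
    intro k
    induction k with
    | zero => intro _; exact ⟨hj, hD, by simpa using ha⟩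
    | succ k ihk =>
      intro hk
      obtain ⟨k1, k2, k3⟩ := ihk (by omega)
      obtain ⟨b, hb1, hb2, hb3⟩ := hInt (j + k) k1
      rw [k2] at hb1 hb2 hb3
      have hab : b = a + k := by
        rw [k3] at hb1
        field_simp at hb1
        exact_mod_cast hb1.symm
      subst hab
      have hlt : j + k < K := by
        rcases k1.lt_or_eq with h | h
        · exact h
        · exfalso
          apply hnd (k + 1) (by omega) hk
          have := hb3 h
          push_cast
          rw [← add_assoc, this]
          exact dvd_pow_self _ (by omega)
      have hp1 := hb2 hlt
      have hp2 : p (j + (k + 1)) = ((a:ℝ) + (k + 1 : ℕ)) / (n:ℝ) ^ D := by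
        rw [← add_assoc, hp1]; push_cast; ring
      refine ⟨hlt, ?_, hp2⟩
      by_contra hne
      have hlt' : d (j + (k + 1)) < D := lt_of_le_of_ne (hmax _ hlt) hne
      obtain ⟨c, hc, -, -⟩ := hInt (j + (k + 1)) hlt
      rw [hp2] at hc
      apply hnd (k + 1) (by omega) hk
      exact dvd_of_eq hn (a := a + (k + 1 : ℕ)) (b := c) hlt' (by rw [← hc]; push_cast; rfl)
  obtain ⟨c1, c2, c3⟩ := claim (n - 1) (by omega)
  obtain ⟨E, rfl⟩ : ∃ E, D = E + 1 := ⟨D - 1, by omega⟩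
  obtain ⟨a, rfl⟩ := hdvd
  rcases c1.lt_or_eq with hlt | heq
  · -- interior caret
    have hpn' : p (j + n) = (((n:ℤ) * a : ℤ) + (n:ℝ)) / (n:ℝ) ^ (E + 1) := by
      obtain ⟨b, hb1, hb2⟩ := hd _ hlt
      rw [show j + (n - 1) + 1 = j + n by omega] at hb2
      rw [c2] at hb1 hb2
      rw [c3] at hb1
      rw [hb2]
      rw [Nat.cast_sub (by omega)] at hb1
      field_simp at hb1 ⊢
      push_cast at hb1 ⊢
      linarith
    obtain ⟨g', hg', hgx⟩ := ih (K - (n - 1)) (by omega)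
      (fun i => if i ≤ j then p i else p (i + (n - 1)))
      (fun i => if i < j then d i else if i = j then E else d (i + (n - 1))) (by
        refine ⟨by simpa using h0, fun i hi => ?_, fun i => ?_⟩
        · rcases lt_trichotomy i j with h | rfl | h
          · simp only [h.le, h, if_true, show i + 1 ≤ j from h]
            exact hd i (by omega)
          · simp only [le_refl, lt_irrefl, if_true, if_false, show ¬ (i + 1 ≤ i) by omega]
            refine ⟨a, ?_, ?_⟩
            · rw [ha, pow_succ]; push_cast; field_simp
            · rw [show i + 1 + (n - 1) = i + n by omega, hpn', pow_succ]; push_cast; field_simp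
          · simp only [show ¬ i ≤ j by omega, show ¬ i < j by omega, show ¬ i = j by omega,
              show ¬ i + 1 ≤ j by omega, if_false]
            rw [show i + 1 + (n - 1) = i + (n - 1) + 1 by ring]
            exact hd _ (by omega)
        · simp only [show ¬ K - (n - 1) + i ≤ j by omega, show ¬ K - (n - 1) < j by omega,
            show ¬ K - (n - 1) = j by omega, if_false]
          rw [show K - (n - 1) + i + (n - 1) = K + i by omega,
            show K - (n - 1) + (n - 1) = K by omega]
          exact ht i)
    obtain ⟨xj, hxj, hxx⟩ := hX j
    refine ⟨g' * xj⁻¹, H.mul_mem hg' (H.inv_mem hxj), fun y hy => ?_⟩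
    obtain ⟨x, hx, rfl⟩ := Fj_surj hn j hy
    rw [hmul_apply, ← hxx x hx, hinv_apply_self, hgx x hx, L_Fj hn p j _ hx]
    intro k hk
    rcases hk.lt_or_eq with h | h
    · rw [(claim k h).2.2, hpn', ha]; push_cast; field_simp; ring
    · rw [h]; field_simp; ring
  · -- terminal caret
    have haD : ((n:ℤ) * a : ℤ) + (n:ℝ) = (n:ℝ) ^ (E + 1) := by
      rw [heq, hpK, ← heq, c2, Nat.cast_sub (by omega)] at c3
      field_simp at c3
      push_cast at c3 ⊢
      linarith
    refine ih j (by omega) p (Function.update d j E) ⟨h0, fun i hi => ?_, fun i => ?_⟩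
    · rw [Function.update_of_ne (by omega)]
      exact hd i (by omega)
    · rw [Function.update_self]
      by_cases hi : i ≤ n - 1
      · rw [(claim i (by omega)).2.2, spine_small hn hi]
        rw [pow_succ] at haD ⊢
        push_cast at haD ⊢
        field_simp
        linarith
      · obtain ⟨i', rfl⟩ : ∃ i', i = i' + (n - 1) := ⟨i - (n - 1), by omega⟩
        rw [show j + (i' + (n - 1)) = K + i' by omega, ht, spine_add hn, ← heq, c2, pow_succ]
        field_simp
        ring

/-- the uniform sequence -/
def unif (n N : ℕ) (i : ℕ) : ℝ :=
  if i ≤ n ^ N - 1 then (i:ℝ) / (n:ℝ) ^ N else 1 - (1 - spine n (i - (n ^ N - 1))) / (n:ℝ) ^ N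

lemma unif_tail (hn : 2 ≤ n) (N : ℕ) : Tail n (unif n N) (n ^ N - 1) N := by
  have hpn := npos hn
  have : 0 < n ^ N := Nat.pow_pos (by omega)
  intro i
  unfold unif
  split_ifs with h
  · have : i = 0 := by omega
    subst this
    rw [spine_zero hn, add_zero, Nat.cast_sub (by omega)]
    push_cast; field_simp; ring
  · rw [Nat.add_sub_cancel_left]

lemma unif_std (hn : 2 ≤ n) (N : ℕ) : Std n (unif n N) (n ^ N - 1) (fun _ => N) := by
  refine ⟨by simp [unif], fun j hj => ⟨j, ?_, ?_⟩, unif_tail hn N⟩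
  · rw [unif, if_pos hj.le]; simp
  · rw [unif, if_pos (show j + 1 ≤ n ^ N - 1 from hj)]; simp

lemma stab_gen (hn : 2 ≤ n) (H : Subgroup (Circle ≃ₜ Circle)) (hX : ∀ j, ∃ g ∈ H, IsX n j g)
    {f : Circle ≃ₜ Circle} (hf : InT n f) (hf0 : f ((0:ℝ) : Circle) = ((0:ℝ) : Circle)) : f ∈ H := by
  have hpn := npos hn
  obtain ⟨F0, -, hl0, h10, N, hG0⟩ := exists_grid hn hf
  have hz : ∃ z : ℤ, F0 0 = z := by
    rw [hl0] at hf0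
    obtain ⟨z, hz⟩ := (coe_eq_iff _ _).1 hf0
    exact ⟨z, by simpa using hz⟩
  obtain ⟨z, hz⟩ := hz
  obtain ⟨F, hl, h1, hG, hF0⟩ : ∃ F : ℝ → ℝ, IsLift f F ∧ (∀ x, F (x + 1) = F x + 1) ∧
      Grid n F N ∧ F 0 = 0 := by
    refine ⟨fun x => F0 x - z, fun x => ?_, fun x => by simp only [h10]; ring, fun k => ?_, by simp only [hz, sub_self]⟩
    · rw [hl0]; exact (coe_eq_iff _ _).2 ⟨z, by ring⟩
    · obtain ⟨a, d, h⟩ := hG0 k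
      refine ⟨a - z * n ^ d, d, fun s hs0 hs1 => ?_⟩
      simp only [h s hs0 hs1]; push_cast; field_simp; ring
  choose a d had using hG
  have hNpos : 0 < n ^ N := Nat.pow_pos (by omega)
  generalize hK : n ^ N - 1 = K
  have hKr : (K:ℝ) + 1 = (n:ℝ) ^ N := by exact_mod_cast (by omega : K + 1 = n ^ N)
  have hpt : Tail n (unif n N) K N := hK ▸ unif_tail hn N
  have hsm : ∀ i, i ≤ K → unif n N i = (i:ℝ) / (n:ℝ) ^ N := by
    intro i hi; rw [unif, if_pos (by omega)]
  have haK : (a K : ℝ) + 1 = (n:ℝ) ^ (d K) := by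
    have := had K 1 zero_le_one le_rfl
    rw [show (((K:ℤ):ℝ) + 1) / (n:ℝ) ^ N = 0 + 1 by push_cast; rw [hKr]; field_simp; simp, h1, hF0] at this
    field_simp at this
    linarith
  -- value of F on the last interval
  have hlast : ∀ s, 0 ≤ s → s ≤ 1 → F (1 - (1 - s) / (n:ℝ) ^ N) = 1 - (1 - s) / (n:ℝ) ^ (d K) := by
    intro s hs0 hs1
    have := had K s hs0 hs1
    rw [show (((K:ℤ):ℝ) + s) / (n:ℝ) ^ N = 1 - (1 - s) / (n:ℝ) ^ N by
      push_cast; rw [show (K:ℝ) = (n:ℝ) ^ N - 1 by linarith]; field_simp; ring] at this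
    rw [this, show (a K:ℝ) = (n:ℝ) ^ (d K) - 1 by linarith]
    field_simp; ring
  have hstd : Std n (fun i => F (unif n N i)) K (fun i => d i) := by
    refine ⟨?_, fun j hj => ⟨a j, ?_, ?_⟩, fun i => ?_⟩
    · simp only []
      rw [hsm 0 (by omega)]; simpa using hF0
    · simp only []
      have := had j 0 le_rfl zero_le_one
      rw [hsm j hj.le]; simpa using this
    · simp only []
      have := had j 1 zero_le_one le_rfl
      rw [hsm _ hj]; push_cast at this ⊢; exact this
    · simp only []
      rw [hpt, hlast _ (spine_nonneg hn i) (spine_lt_one hn i).le]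
  obtain ⟨gp, hgp, hgpx⟩ := std_gen hn H hX K _ _ (hK ▸ unif_std hn N)
  obtain ⟨gq, hgq, hgqx⟩ := std_gen hn H hX K _ _ hstd
  have hFL : ∀ x, 0 ≤ x → F (L (unif n N) x) = L (fun i => F (unif n N i)) x := by
    intro x hx
    obtain ⟨i, s, hs0, hs1, rfl⟩ := decomp hx
    rw [L_eq _ _ hs0 hs1.le, L_eq _ _ hs0 hs1.le]
    by_cases hi : i < K
    · rw [hsm i hi.le, hsm (i + 1) hi]
      have e0 := had i 0 le_rfl zero_le_one
      have e1 := had i 1 zero_le_one le_rfl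
      have es := had i s hs0 hs1.le
      push_cast at e0 e1 es ⊢
      rw [add_zero] at e0
      rw [e0, e1, show (i:ℝ) / (n:ℝ) ^ N + s * ((i + 1) / (n:ℝ) ^ N - i / (n:ℝ) ^ N) =
        (i + s) / (n:ℝ) ^ N by field_simp; ring, es]
      field_simp; ring
    · obtain ⟨k, rfl⟩ : ∃ k, i = K + k := ⟨i - K, by omega⟩
      have a0 := spine_nonneg hn k
      have a1 := spine_lt_one hn k
      have b0 := spine_nonneg hn (k + 1)
      have b1 := spine_lt_one hn (k + 1)
      rw [show K + k + 1 = K + (k + 1) by ring, hpt, hpt, hlast _ a0 a1.le, hlast _ b0 b1.le]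
      have key : ∀ E : ℕ, 1 - (1 - spine n k) / (n:ℝ) ^ E +
          s * (1 - (1 - spine n (k + 1)) / (n:ℝ) ^ E - (1 - (1 - spine n k) / (n:ℝ) ^ E)) =
          1 - (1 - (spine n k + s * (spine n (k + 1) - spine n k))) / (n:ℝ) ^ E := by
        intro E; field_simp; ring
      rw [key, key, hlast _ (by nlinarith) (by nlinarith)]
  have : f = gq * gp⁻¹ := by
    rw [eq_mul_inv_iff_mul_eq]
    apply Homeomorph.ext
    intro c
    obtain ⟨y, hy0, hy1, rfl⟩ := coe_surj c
    obtain ⟨x, hx, rfl⟩ := L_spine_surj hn hy0 hy1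
    rw [hmul_apply, hgpx x hx, hgqx x hx, hl, hFL x hx]
  rw [this]
  exact H.mul_mem hgq (H.inv_mem hgp)

lemma inT_one (hn : 2 ≤ n) : InT n 1 := by
  have := rot_inT hn (nadic_int (n := n) 0)
  have e : rot ((0:ℤ):ℝ) = 1 := by
    apply Homeomorph.ext
    intro p
    obtain ⟨x, -, -, rfl⟩ := coe_surj p
    rw [rot_coe, hone_apply]; simp
  rwa [e] at this

lemma all_X (hn : 2 ≤ n) (H : Subgroup (Circle ≃ₜ Circle)) (hX : ∀ j, j < n → ∃ g ∈ H, IsX n j g) :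
    ∀ j, ∃ g ∈ H, IsX n j g := by
  intro j
  induction j using Nat.strong_induction_on with
  | _ j ih =>
    by_cases h : j < n
    · exact hX j h
    · obtain ⟨i, rfl⟩ : ∃ i, j = i + (n - 1) := ⟨j - (n - 1), by omega⟩
      obtain ⟨g, hg, hgx⟩ := ih i (by omega)
      obtain ⟨x0, hx0, hx0x⟩ := hX 0 (by omega)
      refine ⟨x0 * g * x0⁻¹, H.mul_mem (H.mul_mem hx0 hg) (H.inv_mem hx0), fun y hy => ?_⟩
      obtain ⟨x, hx, rfl⟩ := Fj_surj hn 0 hy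
      rw [hmul_apply, ← hx0x x hx, hinv_apply_self, hmul_apply, hgx x hx,
        hx0x _ (Fj_nonneg hn i hx), Fj_rel hn (by omega) hx]

lemma gen_all (hn : 2 ≤ n) (S : Set (Circle ≃ₜ Circle))
    (hS : ∀ g ∈ S, InT n g ∧ InT n g⁻¹)
    (hX : ∀ j, j < n → ∃ g ∈ S, IsX n j g) (hr : rot (1 / n) ∈ S)
    {f : Circle ≃ₜ Circle} (hf : InT n f) : f ∈ Subgroup.closure S := by
  have hpn := npos hn
  have hX' := all_X hn (Subgroup.closure S) (fun j hj => by
    obtain ⟨g, hg, h⟩ := hX j hj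
    exact ⟨g, Subgroup.subset_closure hg, h⟩)
  have hin : ∀ g ∈ Subgroup.closure S, InT n g ∧ InT n g⁻¹ := by
    intro g hg
    induction hg using Subgroup.closure_induction with
    | mem x hx => exact hS x hx
    | one => exact ⟨inT_one hn, by rw [inv_one]; exact inT_one hn⟩
    | mul x y _ _ hx hy => exact ⟨inT_mul hn hx.1 hy.1, by rw [mul_inv_rev]; exact inT_mul hn hy.2 hx.2⟩
    | inv x _ hx => exact ⟨hx.2, by rw [inv_inv]; exact hx.1⟩
  have horb : ∀ b : ℕ, ∃ h ∈ Subgroup.closure S,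
      h ((0:ℝ) : Circle) = ((spine n b : ℝ) : Circle) := by
    intro b
    induction b using Nat.strong_induction_on with
    | _ b ih =>
      rcases Nat.eq_zero_or_pos b with rfl | hb
      · exact ⟨1, Subgroup.one_mem _, by rw [hone_apply, spine_zero hn]⟩
      by_cases h : b ≤ n - 1
      · obtain ⟨g, hg, hgx⟩ := ih (b - 1) (by omega)
        refine ⟨rot (1 / n) * g, Subgroup.mul_mem _ (Subgroup.subset_closure hr) hg, ?_⟩
        rw [hmul_apply, hgx, rot_coe, spine_small hn h, spine_small hn (by omega),
          Nat.cast_sub hb]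
        congr 1
        field_simp
        simp
      · obtain ⟨i, rfl⟩ : ∃ i, b = i + (n - 1) := ⟨b - (n - 1), by omega⟩
        obtain ⟨g, hg, hgx⟩ := ih i (by omega)
        obtain ⟨x0, hx0, hx0x⟩ := hX' 0
        refine ⟨x0 * g, Subgroup.mul_mem _ hx0 hg, ?_⟩
        have := hx0x i (by positivity)
        rw [L_nat] at this
        rw [hmul_apply, hgx, this]
        have hi : (1:ℝ) ≤ i := by exact_mod_cast (by omega : 1 ≤ i)
        have e : Fj n 0 i = ((i + (n - 1) : ℕ) : ℝ) := by
          rw [Nat.cast_add, Nat.cast_sub (by omega)]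
          unfold Fj
          push_cast
          split_ifs with h1 h2
          · linarith
          · have : (i:ℝ) = 1 := by linarith
            rw [this]; ring
          · rfl
        rw [e, L_nat]
  -- the image of zero
  have h0 : f ((0:ℝ) : Circle) ∈ nAdicPoints n := by
    rw [← hf.1]
    exact ⟨_, (coe_mem_nadic hn 0).2 (by simpa using nadic_int (n := n) 0), rfl⟩
  obtain ⟨y, hy0, hy1, hy⟩ := coe_surj (f ((0:ℝ) : Circle))
  rw [← hy, coe_mem_nadic hn] at h0
  obtain ⟨b, M, rfl⟩ := h0
  have hM : (0:ℝ) < (n:ℝ) ^ M := by positivity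
  have hb0 : 0 ≤ b := by
    rw [le_div_iff₀ hM, zero_mul] at hy0
    exact_mod_cast hy0
  obtain ⟨b, rfl⟩ := Int.eq_ofNat_of_zero_le hb0
  have hb1 : b < n ^ M := by
    rw [div_lt_one hM] at hy1
    exact_mod_cast hy1
  obtain ⟨gp, hgp, hgpx⟩ := std_gen hn _ hX' _ _ _ (unif_std hn M)
  obtain ⟨h, hh, hhx⟩ := horb b
  have hk : (gp * h) ((0:ℝ) : Circle) = f ((0:ℝ) : Circle) := by
    have := hgpx b (by positivity)
    rw [L_nat, L_nat, unif, if_pos (by omega)] at this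
    rw [hmul_apply, hhx, this, ← hy]
    simp
  have hmem := Subgroup.mul_mem _ hgp hh
  have : (gp * h)⁻¹ * f ∈ Subgroup.closure S := by
    apply stab_gen hn _ hX' (inT_mul hn (hin _ hmem).2 hf)
    rw [hmul_apply, ← hk, hinv_apply_self]
  have := Subgroup.mul_mem _ hmem this
  rwa [mul_inv_cancel_left] at this

lemma Tn_infinite (hn : 2 ≤ n) : Infinite (Tn n) := by
  have hpn := npos hn
  have hn1 : (1:ℝ) < n := by exact_mod_cast (by omega : 1 < n)
  let φ : ℕ → Tn n := fun k => ⟨rot (1 / (n:ℝ) ^ (k + 1)),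
    Subgroup.subset_closure (rot_inT hn ⟨1, k + 1, by simp⟩)⟩
  apply Infinite.of_injective φ
  intro k l h
  have h1 : rot (1 / (n:ℝ) ^ (k + 1)) = rot (1 / (n:ℝ) ^ (l + 1)) := congrArg Subtype.val h
  have h2 : rot (1 / (n:ℝ) ^ (k + 1)) ((0:ℝ) : Circle) = rot (1 / (n:ℝ) ^ (l + 1)) ((0:ℝ) : Circle) := by
    rw [h1]
  rw [rot_coe, rot_coe, zero_add, zero_add] at h2
  haveI : Fact ((0:ℝ) < 1) := ⟨zero_lt_one⟩
  have hI : ∀ m : ℕ, 1 / (n:ℝ) ^ (m + 1) ∈ Set.Ico (0:ℝ) (0 + 1) := by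
    intro m
    refine ⟨by positivity, ?_⟩
    rw [zero_add, div_lt_one (by positivity)]
    exact one_lt_pow₀ hn1 (by omega)
  rw [AddCircle.coe_eq_coe_iff_of_mem_Ico (hI k) (hI l)] at h2
  have h3 : (n:ℝ) ^ (k + 1) = (n:ℝ) ^ (l + 1) := by
    field_simp at h2
    exact h2.symm
  have := pow_right_injective₀ hpn hn1.ne' h3
  omega

end generation



/-- For every integer `n ≥ 2`, the group `T_n` is finitely generated;
indeed it is generated by a set of `n+1` elements. -/
theorem Tn_finitely_generated (n : ℕ) (hn : 2 ≤ n) :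
    ∃ S : Finset (Tn n), S.card = n + 1 ∧
      Subgroup.closure (S : Set (Tn n)) = ⊤ := by
  classical
  choose X hX1 hX2 hX3 using exists_X hn
  have hr : IsNAdic n (1 / n) := ⟨1, 1, by simp⟩
  have hrT : InT n (rot (1 / n)) := rot_inT hn hr
  let x : ℕ → Tn n := fun j => ⟨X j, Subgroup.subset_closure (hX1 j)⟩
  let r : Tn n := ⟨rot (1 / n), Subgroup.subset_closure hrT⟩
  let S0 : Finset (Tn n) := insert r ((Finset.range n).image x)
  have hcard : S0.card ≤ n + 1 := by
    refine (Finset.card_insert_le _ _).trans ?_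
    have := Finset.card_image_le (s := Finset.range n) (f := x)
    rw [Finset.card_range] at this
    omega
  have := Tn_infinite hn
  obtain ⟨S, hS, hSc⟩ := Infinite.exists_superset_card_eq S0 (n + 1) hcard
  refine ⟨S, hSc, ?_⟩
  have hmain : Subgroup.closure (S0 : Set (Tn n)) = ⊤ := by
    rw [eq_top_iff]
    have hall : Tn n ≤ (Subgroup.closure (S0 : Set (Tn n))).map (Tn n).subtype := by
      rw [MonoidHom.map_closure]
      refine (Subgroup.closure_le _).2 ?_
      intro f hf
      refine gen_all hn _ ?_ ?_ ?_ hf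
      · rintro g ⟨s, hs, rfl⟩
        rw [Finset.mem_coe, Finset.mem_insert, Finset.mem_image] at hs
        rcases hs with rfl | ⟨j, -, rfl⟩
        · refine ⟨hrT, ?_⟩
          change InT n (rot (1 / n))⁻¹
          rw [rot_inv]
          exact rot_inT hn (nadic_neg hr)
        · exact ⟨hX1 j, hX2 j⟩
      · intro j hj
        exact ⟨X j, ⟨x j, Finset.mem_insert_of_mem
          (Finset.mem_image_of_mem x (Finset.mem_range.2 hj)), rfl⟩, hX3 j⟩
      · exact ⟨r, Finset.mem_insert_self _ _, rfl⟩
    intro g _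
    obtain ⟨s, hs, he⟩ := hall g.2
    have : s = g := Subtype.ext he
    rwa [← this]
  rw [eq_top_iff, ← hmain]
  exact Subgroup.closure_mono (by exact_mod_cast hS)

end ThompsonPaper
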